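/- Let k be a field of characteristic not two and s a three-dimensional simple Lie algebra with Killing form K. The vector space H(s) = k ⊕ s with product (a,v)·(b,w) = (ab + K(v,w)/8, aw + bv + [v,w]/2) is an associative unital algebra; moreover if s ≅ L(α,β) then H(s) is isomorphic to the quaternion algebra (−β, −α / k). -/

import Mathlib

open Quaternion

/-- The bracket of `L(α,β)` on `k³`. -/
def Lbracket {k : Type*} [Field k] (α β : k) (u v : Fin 3 → k) : Fin 3 → k :=
  ![α * (u 1 * v 2 - u 2 * v 1), β * (u 2 * v 0 - u 0 * v 2), u 0 * v 1 - u 1 * v 0]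

/-- The product on `H(s) = k ⊕ s`:
`(a,v)·(b,w) = (ab + K(v,w)/8, aw + bv + [v,w]/2)`. -/
noncomputable def Hmul (k : Type*) [Field k] (L : Type*) [LieRing L] [LieAlgebra k L]
    [Module.Finite k L] (p q : k × L) : k × L :=
  (p.1 * q.1 + killingForm k L p.2 q.2 / 8, p.1 • q.2 + q.1 • p.2 + (2 : k)⁻¹ • ⁅p.2, q.2⁆)

lemma Haux_trace (k : Type*) [Field k] (L : Type*) [LieRing L] [LieAlgebra k L]
    [LieAlgebra.IsSimple k L] (x : L) : LinearMap.trace k L (LieAlgebra.ad k L x) = 0 := by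
  have hb : ∀ u v : L, LinearMap.trace k L (LieAlgebra.ad k L ⁅u, v⁆) = 0 := by
    intro u v
    have : LieAlgebra.ad k L ⁅u, v⁆ = LieAlgebra.ad k L u * LieAlgebra.ad k L v
        - LieAlgebra.ad k L v * LieAlgebra.ad k L u := by
      ext w
      simp
    rw [this, map_sub, LinearMap.trace_mul_comm, sub_self]
  let I : LieIdeal k L :=
    { LinearMap.ker (LinearMap.trace k L ∘ₗ (LieAlgebra.ad k L : L →ₗ[k] Module.End k L)) with
      lie_mem := by
        intro u v _
        exact hb u v }
  have hI : ∀ y : L, y ∈ I ↔ LinearMap.trace k L (LieAlgebra.ad k L y) = 0 := fun y => Iff.rfl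
  rcases LieAlgebra.IsSimple.eq_bot_or_eq_top (R := k) I with h | h
  · exfalso
    apply LieAlgebra.IsSimple.non_abelian (R := k) (L := L)
    refine ⟨fun u v => ?_⟩
    have : ⁅u, v⁆ ∈ I := (hI _).2 (hb u v)
    rw [h] at this
    simpa using this
  · exact (hI x).1 (by rw [h]; trivial)

def HB {k : Type*} [Field k] (a b c d e g : k) (u v : Fin 3 → k) : Fin 3 → k :=
  ![(u 1 * v 2 - u 2 * v 1) * a + (u 2 * v 0 - u 0 * v 2) * d + (u 0 * v 1 - u 1 * v 0) * e,
    (u 1 * v 2 - u 2 * v 1) * d + (u 2 * v 0 - u 0 * v 2) * b + (u 0 * v 1 - u 1 * v 0) * g,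
    (u 1 * v 2 - u 2 * v 1) * e + (u 2 * v 0 - u 0 * v 2) * g + (u 0 * v 1 - u 1 * v 0) * c]

lemma Haux_tr {k : Type*} [Field k] {L : Type*} [AddCommGroup L] [Module k L]
    (f : L ≃ₗ[k] (Fin 3 → k)) (T : L →ₗ[k] L) :
    LinearMap.trace k L T = ∑ i, f (T (f.symm (Pi.single i 1))) i := by
  rw [LinearMap.trace_eq_matrix_trace k (Module.Basis.ofEquivFun f), Matrix.trace]
  refine Finset.sum_congr rfl fun i _ => ?_
  simp [LinearMap.toMatrix_apply]

lemma Haux_killing {k : Type*} [Field k] {L : Type*} [LieRing L] [LieAlgebra k L]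
    [Module.Finite k L] (f : L ≃ₗ[k] (Fin 3 → k)) (a b c d e g : k)
    (h : ∀ u v : L, f ⁅u, v⁆ = HB a b c d e g (f u) (f v)) (u v : L) :
    killingForm k L u v = ∑ i, HB a b c d e g (f u) (HB a b c d e g (f v) (Pi.single i 1)) i := by
  rw [killingForm_apply_apply, Haux_tr f]
  simp [h]

lemma Haux_exists (k : Type*) [Field k] (L : Type*) [LieRing L] [LieAlgebra k L]
    [Module.Finite k L] (hdim : Module.finrank k L = 3) [LieAlgebra.IsSimple k L] :
    ∃ (f : L ≃ₗ[k] (Fin 3 → k)) (a b c d e g : k),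
      ∀ u v : L, f ⁅u, v⁆ = HB a b c d e g (f u) (f v) := by
  let f : L ≃ₗ[k] (Fin 3 → k) := (Module.finBasisOfFinrankEq k L hdim).equivFun
  let E : Fin 3 → L := fun i => f.symm (Pi.single i 1)
  have hexp : ∀ u : L, u = f u 0 • E 0 + f u 1 • E 1 + f u 2 • E 2 := by
    intro u
    apply f.injective
    ext i
    fin_cases i <;> simp [E]
  have hbr : ∀ u v : L, ⁅u, v⁆ = (f u 1 * f v 2 - f u 2 * f v 1) • ⁅E 1, E 2⁆
      + (f u 2 * f v 0 - f u 0 * f v 2) • ⁅E 2, E 0⁆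
      + (f u 0 * f v 1 - f u 1 * f v 0) • ⁅E 0, E 1⁆ := by
    intro u v
    conv_lhs => rw [hexp u, hexp v]
    simp only [lie_add, add_lie, lie_smul, smul_lie, lie_self]
    rw [← lie_skew (E 0) (E 2), ← lie_skew (E 1) (E 0), ← lie_skew (E 2) (E 1)]
    module
  have ht : ∀ x : L, ∑ i, f ⁅x, E i⁆ i = 0 := by
    intro x
    have := Haux_trace k L x
    rw [Haux_tr f] at this
    exact this
  have h0 := ht (E 0)
  have h1 := ht (E 1)
  have h2 := ht (E 2)
  rw [Fin.sum_univ_three] at h0 h1 h2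
  rw [← lie_skew (E 0) (E 2)] at h0
  rw [← lie_skew (E 1) (E 0)] at h1
  rw [← lie_skew (E 2) (E 1)] at h2
  simp only [lie_self, map_zero, map_neg, Pi.zero_apply, Pi.neg_apply] at h0 h1 h2
  refine ⟨f, f ⁅E 1, E 2⁆ 0, f ⁅E 2, E 0⁆ 1, f ⁅E 0, E 1⁆ 2, f ⁅E 1, E 2⁆ 1, f ⁅E 1, E 2⁆ 2,
    f ⁅E 2, E 0⁆ 2, fun u v => ?_⟩
  have k0 : f ⁅E 0, E 1⁆ 1 = f ⁅E 2, E 0⁆ 2 := by linear_combination h0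
  have k1 : f ⁅E 0, E 1⁆ 0 = f ⁅E 1, E 2⁆ 2 := by linear_combination -h1
  have k2 : f ⁅E 2, E 0⁆ 0 = f ⁅E 1, E 2⁆ 1 := by linear_combination h2
  rw [hbr u v]
  ext i
  fin_cases i <;> simp [HB, k0, k1, k2]

lemma Haux_assoc (k : Type*) [Field k] (L : Type*) [LieRing L] [LieAlgebra k L]
    [Module.Finite k L] (hdim : Module.finrank k L = 3) [LieAlgebra.IsSimple k L] (u v w : L) :
    killingForm k L u v • w - killingForm k L v w • u = (2 : k) • ⁅v, ⁅u, w⁆⁆ := by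
  obtain ⟨f, a, b, c, d, e, g, h⟩ := Haux_exists k L hdim
  apply f.injective
  simp only [map_sub, map_smul, h, Haux_killing f a b c d e g h, Fin.sum_univ_three]
  ext i
  fin_cases i <;> simp [HB] <;> ring

/-- For a three-dimensional simple Lie algebra `s`, the product on `H(s) = k ⊕ s` makes it an
associative unital algebra; moreover, if `s ≅ L(α,β)` then `H(s)` is isomorphic to the
quaternion algebra `(−β, −α / k)`. -/
theorem H_quaternion_algebra (k : Type*) [Field k] (hchar : (2 : k) ≠ 0)
    (L : Type*) [LieRing L] [LieAlgebra k L] [Module.Finite k L]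
    (hdim : Module.finrank k L = 3) [LieAlgebra.IsSimple k L] :
    (∀ p q r : k × L, Hmul k L (Hmul k L p q) r = Hmul k L p (Hmul k L q r)) ∧
    (∀ p : k × L, Hmul k L ((1 : k), (0 : L)) p = p ∧ Hmul k L p ((1 : k), (0 : L)) = p) ∧
    (∀ p q r : k × L, Hmul k L p (q + r) = Hmul k L p q + Hmul k L p r) ∧
    (∀ p q r : k × L, Hmul k L (p + q) r = Hmul k L p r + Hmul k L q r) ∧
    (∀ (c : k) (p q : k × L), Hmul k L (c • p) q = c • Hmul k L p q
        ∧ Hmul k L p (c • q) = c • Hmul k L p q) ∧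
    (∀ α β : k, α ≠ 0 → β ≠ 0 →
      (∃ f : L ≃ₗ[k] (Fin 3 → k), ∀ u v : L, f ⁅u, v⁆ = Lbracket α β (f u) (f v)) →
      ∃ e : (k × L) ≃ₗ[k] ℍ[k, -β, -α],
        e ((1 : k), (0 : L)) = 1 ∧ ∀ p q : k × L, e (Hmul k L p q) = e p * e q) := by
  have h8 : (8 : k) ≠ 0 := by
    have : (8 : k) = 2 * 2 * 2 := by norm_num
    rw [this]; simp [hchar]
  have h4 : (4 : k) ≠ 0 := by
    have : (4 : k) = 2 * 2 := by norm_num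
    rw [this]; simp [hchar]
  refine ⟨?_, ?_, ?_, ?_, ?_, ?_⟩
  · rintro ⟨a, u⟩ ⟨b, v⟩ ⟨c, w⟩
    have hinv : killingForm k L ⁅u, v⁆ w = killingForm k L u ⁅v, w⁆ :=
      LieModule.traceForm_apply_lie_apply k L L u v w
    have hA := Haux_assoc k L hdim u v w
    have hJ : ⁅⁅u, v⁆, w⁆ = ⁅u, ⁅v, w⁆⁆ - ⁅v, ⁅u, w⁆⁆ := by
      rw [leibniz_lie u v w]; abel
    ext
    · simp only [Hmul, map_add, map_smul, LinearMap.add_apply, LinearMap.smul_apply, smul_eq_mul,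
        hinv]
      ring
    · simp only [Hmul, lie_add, add_lie, lie_smul, smul_lie, hJ]
      have h2 : ⁅v, ⁅u, w⁆⁆ = (2 : k)⁻¹ • (killingForm k L u v • w - killingForm k L v w • u) := by
        rw [hA, smul_smul, inv_mul_cancel₀ hchar, one_smul]
      rw [h2]
      have e8 : (8 : k)⁻¹ = 2⁻¹ * 2⁻¹ * 2⁻¹ := by rw [← mul_inv, ← mul_inv]; norm_num
      simp only [div_eq_mul_inv, e8]
      module
  · rintro ⟨a, u⟩
    constructor <;> simp [Hmul]
  · rintro ⟨a, u⟩ ⟨b, v⟩ ⟨c, w⟩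
    ext
    · simp [Hmul]; ring
    · simp [Hmul]; module
  · rintro ⟨a, u⟩ ⟨b, v⟩ ⟨c, w⟩
    ext
    · simp [Hmul]; ring
    · simp [Hmul]; module
  · rintro c ⟨a, u⟩ ⟨b, v⟩
    constructor
    · ext
      · simp [Hmul]; ring
      · simp [Hmul]; module
    · ext
      · simp [Hmul]; ring
      · simp [Hmul]; module
  · rintro α β - - ⟨f, hf⟩
    have h : ∀ u v : L, f ⁅u, v⁆ = HB α β 1 0 0 0 (f u) (f v) := by
      intro u v
      rw [hf]
      ext i
      fin_cases i <;> simp [HB, Lbracket] <;> ring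
    let e : (k × L) ≃ₗ[k] ℍ[k, -β, -α] :=
      { toFun := fun p => ⟨p.1, f p.2 0 / 2, f p.2 1 / 2, f p.2 2 / 2⟩
        invFun := fun q => (q.re, f.symm ![2 * q.imI, 2 * q.imJ, 2 * q.imK])
        map_add' := by
          intro p q
          ext <;> simp <;> ring
        map_smul' := by
          intro c p
          ext <;> simp <;> ring
        left_inv := by
          rintro ⟨a, u⟩
          ext
          · rfl
          · apply f.injective
            ext i
            fin_cases i <;> simp <;> field_simp
        right_inv := by
          intro q
          ext <;> simp [hchar] }
    have he : ∀ p, e p = ⟨p.1, f p.2 0 / 2, f p.2 1 / 2, f p.2 2 / 2⟩ := fun p => rfl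
    refine ⟨e, ?_, ?_⟩
    · rw [he]; ext <;> simp
    · rintro ⟨a, u⟩ ⟨b, v⟩
      simp only [he, Hmul, Haux_killing f _ _ _ _ _ _ h, Fin.sum_univ_three]
      ext <;> simp [h, HB] <;> field_simp <;> ring
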